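/- (Finite determination for switched linear systems with quadratic constraints.) Let 𝒜 = {A_1,…,A_M} ⊆ ℝ^{n×n} and suppose all products of matrices from 𝒜 tend to zero uniformly in length: for every ε > 0 there exists K ∈ ℕ such that every product A_{i_1} ⋯ A_{i_k} with k ≥ K and i_j ∈ {1,…,M} has norm less than ε (this holds precisely when the joint spectral radius ρ(𝒜) < 1). Suppose Ω is compact with the origin in its interior, X = Ω, and Q_1 = (1/D_x) I_n with q_1 = 0 for some D_x > 0. Then there exists a finite k* ∈ ℕ such that for every Q ∈ 𝒬_{k*+1} \ 𝒬_{k*} there exists N ∈ cone(𝒬_{k*}) with Q ⪯ N, and consequently O_{k*+1} = O_{k*} and the maximal constraint-admissible invariant set O_∞ := ∩_{k ∈ ℕ} O_k equals O_{k*}. -/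

import Mathlib

open Matrix

attribute [local instance] Matrix.normedAddCommGroup

/-- The cone (set of nonnegative linear combinations) generated by a set of matrices. -/
def matCone {α : Type*} [AddCommMonoid α] [Module ℝ α] (S : Set α) : Set α :=
  { M | ∃ (t : Finset α) (c : α → ℝ), (↑t : Set α) ⊆ S ∧ (∀ x ∈ t, 0 ≤ c x) ∧
      M = ∑ x ∈ t, c x • x }

/-- A symmetric matrix whose entries are all at most `δ` in absolute value is dominated by
`c • 1` as soon as `δ` times the dimension is at most `c`. -/
theorem posSemidef_smul_one_sub_of_abs_le {m : Type*} [Fintype m] [DecidableEq m]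
    {E : Matrix m m ℝ} (hE : Eᵀ = E) {c δ : ℝ} (hδ : ∀ a b, |E a b| ≤ δ)
    (hc : δ * Fintype.card m ≤ c) : (c • (1 : Matrix m m ℝ) - E).PosSemidef := by
  refine PosSemidef.of_dotProduct_mulVec_nonneg ?_ fun x => ?_
  · simp [IsHermitian, conjTranspose_eq_transpose_of_trivial, hE]
  · have hxx : 0 ≤ ∑ a, x a ^ 2 := Finset.sum_nonneg fun a _ => sq_nonneg _
    have hform : x ⬝ᵥ E *ᵥ x = ∑ a, ∑ b, x a * E a b * x b := by
      simp only [dotProduct, mulVec, Finset.mul_sum, mul_assoc]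
    have hterm (a b : m) : x a * E a b * x b ≤ δ * ((x a ^ 2 + x b ^ 2) / 2) := by
      have h₁ : x a * E a b * x b ≤ |E a b| * |x a * x b| := by
        rw [← abs_mul]
        exact (le_of_eq (by ring)).trans (le_abs_self _)
      have h₂ : |x a * x b| ≤ (x a ^ 2 + x b ^ 2) / 2 := by
        rw [abs_le]
        constructor <;> nlinarith [sq_nonneg (x a + x b), sq_nonneg (x a - x b)]
      exact h₁.trans (mul_le_mul (hδ a b) h₂ (abs_nonneg _) ((abs_nonneg _).trans (hδ a b)))
    have hbound : x ⬝ᵥ E *ᵥ x ≤ δ * Fintype.card m * ∑ a, x a ^ 2 := by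
      rw [hform]
      refine (Finset.sum_le_sum fun a _ => Finset.sum_le_sum fun b _ => hterm a b).trans_eq ?_
      simp only [← Finset.mul_sum, ← Finset.sum_div, Finset.sum_add_distrib, Finset.sum_const,
        Finset.card_univ, nsmul_eq_mul]
      ring
    have hone : x ⬝ᵥ x = ∑ a, x a ^ 2 := by simp only [dotProduct, sq]
    simp only [star_trivial, sub_mulVec, smul_mulVec, one_mulVec, dotProduct_sub,
      dotProduct_smul, smul_eq_mul, hone]
    nlinarith [mul_le_mul_of_nonneg_right hc hxx]

/-- For a small matrix `B`, conjugating `N` by `diag(B, 1)` gives a matrix dominated by a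
block diagonal matrix whose corner strictly exceeds that of `N`. -/
theorem exists_pos_posSemidef_sub_conj {m : Type*} [Fintype m] [DecidableEq m]
    {N : Matrix (m ⊕ Unit) (m ⊕ Unit) ℝ} (hN : Nᵀ = N) {a d : ℝ} (ha : 0 < a)
    (hd : N (Sum.inr ()) (Sum.inr ()) < d) :
    ∃ ε > 0, ∀ B : Matrix m m ℝ, ‖B‖ < ε →
      (fromBlocks (a • (1 : Matrix m m ℝ)) 0 0 (of fun _ _ : Unit => d) -
        (fromBlocks B 0 0 (1 : Matrix Unit Unit ℝ))ᵀ * N * fromBlocks B 0 0 1).PosSemidef := by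
  obtain ⟨s, hs⟩ : ∃ s, s = N (Sum.inr ()) (Sum.inr ()) := ⟨_, rfl⟩
  rw [← hs] at hd
  let S : Matrix (m ⊕ Unit) (m ⊕ Unit) ℝ := fromBlocks 0 0 0 (of fun _ _ : Unit => s)
  let E : Matrix m m ℝ → Matrix (m ⊕ Unit) (m ⊕ Unit) ℝ := fun B =>
    (fromBlocks B 0 0 (1 : Matrix Unit Unit ℝ))ᵀ * N * fromBlocks B 0 0 1 - S
  have hEcont : Continuous E := by
    have hblock : Continuous fun B : Matrix m m ℝ =>
        fromBlocks B 0 0 (1 : Matrix Unit Unit ℝ) :=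
      continuous_id.matrix_fromBlocks continuous_const continuous_const continuous_const
    exact ((hblock.matrix_transpose.matrix_mul continuous_const).matrix_mul hblock).sub
      continuous_const
  have hE0 : E 0 = 0 := by
    ext i j
    rcases i with i | i <;> rcases j with j | j <;>
      simp [E, S, mul_apply, fromBlocks_transpose, hs]
  let c : ℝ := min a (d - s)
  have hc : 0 < c := lt_min ha (sub_pos.2 hd)
  let δ : ℝ := c / Fintype.card (m ⊕ Unit)
  have hcard : (0 : ℝ) < Fintype.card (m ⊕ Unit) := by
    exact_mod_cast Fintype.card_pos
  have hδ : 0 < δ := div_pos hc hcard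
  obtain ⟨ε, hε, hεE⟩ := Metric.continuous_iff.1 hEcont 0 δ hδ
  refine ⟨ε, hε, fun B hB => ?_⟩
  have hEB : ‖E B‖ < δ := by
    simpa only [hE0, dist_zero_right] using hεE B (by rwa [dist_zero_right])
  have hsymm : (E B)ᵀ = E B := by
    simp [E, S, transpose_mul, transpose_sub, fromBlocks_transpose, hN, Matrix.mul_assoc]
    rfl
  have hpsd : (c • (1 : Matrix (m ⊕ Unit) (m ⊕ Unit) ℝ) - E B).PosSemidef :=
    posSemidef_smul_one_sub_of_abs_le hsymm
      (fun i j => (norm_entry_le_entrywise_sup_norm (E B)).trans hEB.le)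
      (div_mul_cancel₀ c hcard.ne').le
  have hdiag : (diagonal (Sum.elim (fun _ : m => a - c) fun _ : Unit => d - s - c)).PosSemidef := by
    refine PosSemidef.diagonal fun i => ?_
    rcases i with i | i
    · exact sub_nonneg.2 (min_le_left _ _)
    · exact sub_nonneg.2 (min_le_right _ _)
  convert hdiag.add hpsd using 1
  ext i j
  rcases i with i | i <;> rcases j with j | j <;>
    simp [E, S, diagonal_apply, one_apply]
  split_ifs <;> ring

/-- Evaluating a quadratic form is monotone for the Loewner order. -/
theorem dotProduct_mulVec_le_of_posSemidef_sub {m : Type*} [Fintype m] {N N' : Matrix m m ℝ}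
    (h : (N - N').PosSemidef) (x : m → ℝ) : x ⬝ᵥ N' *ᵥ x ≤ x ⬝ᵥ N *ᵥ x := by
  have := h.dotProduct_mulVec_nonneg x
  simp only [star_trivial, sub_mulVec, dotProduct_sub] at this
  linarith

/-- A vector at which all forms in `S` are nonpositive makes all forms in `matCone S`
nonpositive. -/
theorem dotProduct_mulVec_nonpos_of_mem_matCone {m : Type*} [Fintype m]
    {S : Set (Matrix m m ℝ)} {x : m → ℝ} (hS : ∀ N ∈ S, x ⬝ᵥ N *ᵥ x ≤ 0)
    {N : Matrix m m ℝ} (hN : N ∈ matCone S) : x ⬝ᵥ N *ᵥ x ≤ 0 := by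
  obtain ⟨t, c, ht, hc, rfl⟩ := hN
  rw [sum_mulVec, dotProduct_sum]
  refine Finset.sum_nonpos fun y hy => ?_
  rw [smul_mulVec, dotProduct_smul, smul_eq_mul]
  exact mul_nonpos_of_nonneg_of_nonpos (hc y hy) (hS y (ht hy))

theorem smul_mem_matCone {α : Type*} [AddCommMonoid α] [Module ℝ α] {S : Set α} {x : α}
    (hx : x ∈ S) {r : ℝ} (hr : 0 ≤ r) : r • x ∈ matCone S :=
  ⟨{x}, fun _ => r, by simpa using hx, fun _ _ => hr, by simp⟩

/-- Elements appearing first at stage `k` of the iterated conjugation are conjugates of initial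
elements by products of exactly `k` matrices. -/
theorem exists_list_conj_of_mem_diff {m ι κ : Type*} [Fintype m] [DecidableEq m]
    {T : κ → Matrix m m ℝ} {R : ι → Matrix m m ℝ} {𝒬 : ℕ → Set (Matrix m m ℝ)}
    (h0 : 𝒬 0 = Set.range R)
    (hsucc : ∀ k, 𝒬 (k + 1) = 𝒬 k ∪ {N | ∃ L ∈ 𝒬 k, ∃ j, N = (T j)ᵀ * L * T j}) (k : ℕ) :
    ∀ N ∈ 𝒬 (k + 1) \ 𝒬 k, ∃ (l : List κ) (i : ι), l.length = k + 1 ∧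
      N = ((l.map T).prod)ᵀ * R i * (l.map T).prod := by
  induction k with
  | zero =>
    rintro N ⟨hN, hN'⟩
    rw [hsucc] at hN
    obtain ⟨L, hL, j, rfl⟩ := hN.resolve_left hN'
    rw [h0] at hL
    obtain ⟨i, rfl⟩ := hL
    exact ⟨[j], i, rfl, by simp⟩
  | succ k ih =>
    rintro N ⟨hN, hN'⟩
    rw [hsucc] at hN
    obtain ⟨L, hL, j, rfl⟩ := hN.resolve_left hN'
    have hL' : L ∉ 𝒬 k := fun h => hN' (by rw [hsucc]; exact Or.inr ⟨L, h, j, rfl⟩)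
    obtain ⟨l, i, hl, rfl⟩ := ih L ⟨hL, hL'⟩
    refine ⟨l ++ [j], i, by simp [hl], ?_⟩
    simp only [List.map_append, List.map_cons, List.map_nil, List.prod_append, List.prod_singleton,
      transpose_mul, Matrix.mul_assoc]

theorem list_prod_fromBlocks_one {m κ : Type*} [Fintype m] [DecidableEq m]
    (A : κ → Matrix m m ℝ) (l : List κ) :
    (l.map fun j => fromBlocks (A j) 0 0 (1 : Matrix Unit Unit ℝ)).prod =
      fromBlocks (l.map A).prod 0 0 1 := by
  induction l with
  | nil => simp
  | cons j l ih => simp [ih, fromBlocks_multiply]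

/-- Finite determination for switched linear systems with quadratic constraints: if all
products of matrices from 𝒜 = {A_1,…,A_M} tend to zero uniformly in length (i.e. the
joint spectral radius is < 1), Ω is compact with 0 in its interior, X = Ω, and
Q_1 = (1/D_x)I with q_1 = 0, then there is a finite k* such that every matrix of
𝒬_{k*+1} \ 𝒬_{k*} is dominated by an element of cone(𝒬_{k*}); consequently
O_{k*+1} = O_{k*} and O_∞ := ⋂_k O_k equals O_{k*}. -/
theorem finite_determination_switched (n M p : ℕ) (hp : 0 < p)
    (A : Fin M → Matrix (Fin n) (Fin n) ℝ)
    (hJSR : ∀ ε : ℝ, 0 < ε → ∃ K : ℕ, ∀ k : ℕ, K ≤ k → ∀ idx : Fin k → Fin M,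
      ‖(List.ofFn fun j => A (idx j)).prod‖ < ε)
    (Q : Fin p → Matrix (Fin n) (Fin n) ℝ) (q : Fin p → Fin n → ℝ)
    (hQsymm : ∀ i, (Q i)ᵀ = Q i)
    (Ω : Set (Fin n → ℝ))
    (hΩ : Ω = {x : Fin n → ℝ | ∀ i : Fin p, x ⬝ᵥ (Q i).mulVec x + 2 * (q i ⬝ᵥ x) ≤ 1})
    (hΩcompact : IsCompact Ω) (hΩint : (0 : Fin n → ℝ) ∈ interior Ω)
    (Dx : ℝ) (hDx : 0 < Dx)
    (hQ1 : Q ⟨0, hp⟩ = (1 / Dx) • (1 : Matrix (Fin n) (Fin n) ℝ))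
    (hq1 : q ⟨0, hp⟩ = 0)
    (X : Set (Fin n → ℝ)) (hX : X = Ω)
    (O : ℕ → Set (Fin n → ℝ)) (hO0 : O 0 = X)
    (hOsucc : ∀ k : ℕ, O (k + 1) =
      O k ∩ {x : Fin n → ℝ | ∀ j : Fin M, (A j).mulVec x ∈ O k})
    (Abar : Fin M → Matrix (Fin n ⊕ Unit) (Fin n ⊕ Unit) ℝ)
    (hAbar : ∀ j, Abar j = Matrix.fromBlocks (A j) 0 0 1)
    (Qbar : Fin p → Matrix (Fin n ⊕ Unit) (Fin n ⊕ Unit) ℝ)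
    (hQbar : ∀ i, Qbar i = Matrix.fromBlocks (Q i) (Matrix.of fun r (_ : Unit) => q i r)
      (Matrix.of fun (_ : Unit) c => q i c) (Matrix.of fun (_ : Unit) (_ : Unit) => (-1 : ℝ)))
    (𝒬 : ℕ → Set (Matrix (Fin n ⊕ Unit) (Fin n ⊕ Unit) ℝ))
    (h𝒬0 : 𝒬 0 = Set.range Qbar)
    (h𝒬succ : ∀ k : ℕ, 𝒬 (k + 1) =
      𝒬 k ∪ {N | ∃ Mq ∈ 𝒬 k, ∃ j : Fin M, N = (Abar j)ᵀ * Mq * Abar j}) :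
    ∃ kstar : ℕ,
      (∀ Q' ∈ 𝒬 (kstar + 1) \ 𝒬 kstar,
        ∃ N ∈ matCone (𝒬 kstar), (N - Q').PosSemidef) ∧
      O (kstar + 1) = O kstar ∧
      (⋂ k : ℕ, O k) = O kstar := by
  subst hX
  obtain rfl : Abar = fun j => fromBlocks (A j) 0 0 1 := funext hAbar
  have hmono : ∀ k, 𝒬 0 ⊆ 𝒬 k := fun k => by
    induction k with
    | zero => exact subset_rfl
    | succ k ih => exact ih.trans (by rw [h𝒬succ]; exact Set.subset_union_left)
  have hdom : ∃ k, ∀ Q' ∈ 𝒬 (k + 1) \ 𝒬 k, ∃ N ∈ matCone (𝒬 k), (N - Q').PosSemidef := by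
    have hsymm (i : Fin p) : (Qbar i)ᵀ = Qbar i := by
      rw [hQbar, fromBlocks_transpose, hQsymm]
      rfl
    choose ε hε hεQ using fun i => exists_pos_posSemidef_sub_conj (hsymm i)
      (a := 1 / 2 * (1 / Dx)) (d := -1 / 2) (by positivity) (by rw [hQbar]; norm_num)
    have : Nonempty (Fin p) := ⟨⟨0, hp⟩⟩
    obtain ⟨i₀, hi₀⟩ := Finite.exists_min ε
    obtain ⟨K, hK⟩ := hJSR (ε i₀) (hε i₀)
    refine ⟨K, fun Q' hQ' => ⟨(1 / 2 : ℝ) • Qbar ⟨0, hp⟩,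
      smul_mem_matCone (hmono K (by rw [h𝒬0]; exact ⟨_, rfl⟩)) (by norm_num), ?_⟩⟩
    obtain ⟨l, i, hl, rfl⟩ := exists_list_conj_of_mem_diff h𝒬0 h𝒬succ K Q' hQ'
    rw [list_prod_fromBlocks_one]
    have hnorm : ‖(l.map A).prod‖ < ε i := by
      have := hK l.length (by omega) l.get
      rw [← Function.comp_def, ← List.map_ofFn, List.ofFn_get] at this
      exact this.trans_le (hi₀ i)
    convert hεQ i _ hnorm using 2
    rw [hQbar, hQ1, hq1, fromBlocks_smul, smul_smul]
    congr 1 <;> ext <;> norm_num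
  have hO : ∀ k, O k = {x | ∀ N ∈ 𝒬 k,
      Sum.elim x (fun _ => 1) ⬝ᵥ N *ᵥ Sum.elim x (fun _ => 1) ≤ 0} := by
    intro k
    induction k with
    | zero =>
      rw [hO0, hΩ, h𝒬0]
      ext x
      simp only [Set.mem_ofPred_eq, Set.forall_mem_range]
      refine forall_congr' fun i => ?_
      have hform : Sum.elim x (fun _ => 1) ⬝ᵥ Qbar i *ᵥ Sum.elim x (fun _ => 1) =
          x ⬝ᵥ Q i *ᵥ x + 2 * (q i ⬝ᵥ x) - 1 := by
        have h₁ : (of fun r (_ : Unit) => q i r) *ᵥ (fun _ => (1 : ℝ)) = q i := by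
          ext; simp [mulVec, dotProduct]
        have h₂ : (of fun (_ : Unit) c => q i c) *ᵥ x = fun _ => q i ⬝ᵥ x := rfl
        rw [hQbar, fromBlocks_mulVec]
        simp only [Sum.elim_comp_inl, Sum.elim_comp_inr, sumElim_dotProduct_sumElim, h₁, h₂,
          dotProduct_add, dotProduct_comm x (q i)]
        simp [dotProduct, mulVec]
        ring
      rw [hform, sub_nonpos]
    | succ k ih =>
      rw [hOsucc, h𝒬succ, ih]
      ext x
      have hlift (j : Fin M) : fromBlocks (A j) 0 0 (1 : Matrix Unit Unit ℝ) *ᵥ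
          Sum.elim x (fun _ => 1) = Sum.elim (A j *ᵥ x) (fun _ => 1) := by
        simp [fromBlocks_mulVec]
      have hconj (N : Matrix (Fin n ⊕ Unit) (Fin n ⊕ Unit) ℝ) (j : Fin M) :
          Sum.elim x (fun _ => 1) ⬝ᵥ ((fromBlocks (A j) 0 0 (1 : Matrix Unit Unit ℝ))ᵀ * N *
            fromBlocks (A j) 0 0 1) *ᵥ Sum.elim x (fun _ => 1) =
          Sum.elim (A j *ᵥ x) (fun _ => 1) ⬝ᵥ N *ᵥ Sum.elim (A j *ᵥ x) (fun _ => 1) := by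
        rw [← mulVec_mulVec, ← mulVec_mulVec, hlift, dotProduct_mulVec, vecMul_transpose, hlift]
      constructor
      · rintro ⟨hx, hAx⟩ N (hN | ⟨L, hL, j, rfl⟩)
        · exact hx N hN
        · rw [hconj]
          exact hAx j L hL
      · refine fun h => ⟨fun N hN => h N (Or.inl hN), fun j L hL => ?_⟩
        rw [← hconj]
        exact h _ (Or.inr ⟨L, hL, j, rfl⟩)
  obtain ⟨k, hk⟩ := hdom
  have hstep : O (k + 1) = O k := by
    refine Set.Subset.antisymm (by rw [hOsucc]; exact Set.inter_subset_left) fun x hx => ?_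
    rw [hO] at hx ⊢
    intro Q' hQ'
    by_cases hmem : Q' ∈ 𝒬 k
    · exact hx Q' hmem
    · obtain ⟨N, hN, hpsd⟩ := hk Q' ⟨hQ', hmem⟩
      exact (dotProduct_mulVec_le_of_posSemidef_sub hpsd _).trans
        (dotProduct_mulVec_nonpos_of_mem_matCone hx hN)
  refine ⟨k, hk, hstep, Set.Subset.antisymm (Set.iInter_subset _ k) (Set.subset_iInter fun l => ?_)⟩
  have hanti : Antitone O :=
    antitone_nat_of_succ_le fun l => by rw [hOsucc]; exact Set.inter_subset_left
  have hconst (r : ℕ) : O (k + r) = O k := by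
    induction r with
    | zero => rfl
    | succ r ih => rw [← add_assoc, hOsucc, ih, ← hOsucc, hstep]
  rw [← hconst l]
  exact hanti (Nat.le_add_left l k)
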